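/- Let x be uniformly distributed on S^{d-1} and f : S^{d-1} → ℝ be L-Lipschitz with respect to the Euclidean metric. Then there exists an absolute constant c > 0 such that for every t ≥ 0, P(|f(x) - E[f(x)]| ≥ t) ≤ 2 exp(-c d t² / L²). -/

import Mathlib

open MeasureTheory

/-- Haar probability measures on compact groups are right-invariant. -/
lemma isMulRightInvariant_of_compactSpace {G : Type*} [Group G] [TopologicalSpace G]
    [IsTopologicalGroup G] [CompactSpace G] [MeasurableSpace G] [BorelSpace G]
    (μ : Measure G) [μ.IsHaarMeasure] [IsProbabilityMeasure μ] : μ.IsMulRightInvariant := by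
  refine ⟨fun g => ?_⟩
  have : IsProbabilityMeasure (μ.map (· * g)) :=
    Measure.isProbabilityMeasure_map (measurable_mul_const g).aemeasurable
  exact Measure.isHaarMeasure_eq_of_isProbabilityMeasure _ _

lemma exists_isHaarMeasure_isProbabilityMeasure (G : Type*) [Group G] [TopologicalSpace G]
    [IsTopologicalGroup G] [CompactSpace G] [MeasurableSpace G] [BorelSpace G] :
    ∃ μ : Measure G, μ.IsHaarMeasure ∧ IsProbabilityMeasure μ :=
  ⟨Measure.haarMeasure ⊤, inferInstance, ⟨Measure.haarMeasure_self⟩⟩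

lemma Continuous.integrable_of_compactSpace {X : Type*} [TopologicalSpace X] [CompactSpace X]
    [MeasurableSpace X] [OpensMeasurableSpace X] {μ : Measure X} [IsFiniteMeasure μ]
    {f : X → ℝ} (hf : Continuous f) : Integrable f μ :=
  hf.integrable_of_hasCompactSupport (HasCompactSupport.of_compactSpace f)

section OrthogonalGroup

variable {E : Type*} [NormedAddCommGroup E] [InnerProductSpace ℝ E] [FiniteDimensional ℝ E]

instance compactSpace_unitary_clm : CompactSpace (unitary (E →L[ℝ] E)) := by
  refine isCompact_iff_compactSpace.mp (Metric.isCompact_of_isClosed_isBounded isClosed_unitary ?_)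
  refine (Metric.isBounded_closedBall (x := (0 : E →L[ℝ] E)) (r := 1)).subset fun U hU => ?_
  rw [mem_closedBall_zero_iff]
  refine ContinuousLinearMap.opNorm_le_bound _ zero_le_one fun x => ?_
  rw [one_mul]
  exact ((Unitary.linearIsometryEquiv ⟨U, hU⟩).norm_map x).le

lemma unitary_norm_map (O : unitary (E →L[ℝ] E)) (x : E) : ‖O.1 x‖ = ‖x‖ :=
  (Unitary.linearIsometryEquiv O).norm_map x

lemma unitary_inner_map (O : unitary (E →L[ℝ] E)) (x y : E) :
    inner ℝ (O.1 x) (O.1 y) = inner ℝ x y :=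
  (Unitary.linearIsometryEquiv O).inner_map_map x y

lemma unitary_symm_apply (R : E ≃ₗᵢ[ℝ] E) (x : E) :
    (Unitary.linearIsometryEquiv.symm R).1 x = R x := rfl

lemma continuous_unitary_apply {X : Type*} [TopologicalSpace X] {g : X → unitary (E →L[ℝ] E)}
    {u : X → E} (hg : Continuous g) (hu : Continuous u) : Continuous fun p => (g p).1 (u p) :=
  (continuous_subtype_val.comp hg).clm_apply hu

lemma unitary_mul_apply (O P : unitary (E →L[ℝ] E)) (x : E) : (O * P).1 x = O.1 (P.1 x) := rfl

/-- The orthogonal group acts transitively on orthonormal pairs. -/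
lemma exists_unitary_map_pair {a v a' v' : E} (ha : ‖a‖ = 1) (hv : ‖v‖ = 1)
    (hav : inner ℝ a v = 0) (ha' : ‖a'‖ = 1) (hv' : ‖v'‖ = 1) (hav' : inner ℝ a' v' = 0) :
    ∃ O : unitary (E →L[ℝ] E), O.1 a = a' ∧ O.1 v = v' := by
  classical
  have ext (x y : E) (hx : ‖x‖ = 1) (hy : ‖y‖ = 1) (hxy : inner ℝ x y = 0)
      (i j : Fin (Module.finrank ℝ E)) (hij : i ≠ j) :
      ∃ b : OrthonormalBasis (Fin (Module.finrank ℝ E)) ℝ E, b i = x ∧ b j = y := by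
    obtain ⟨b, hb⟩ := Orthonormal.exists_orthonormalBasis_extension_of_card_eq (𝕜 := ℝ)
      (E := E) (ι := Fin (Module.finrank ℝ E)) (by simp)
      (v := fun k => if k = i then x else y) (s := {i, j}) (by
        rw [orthonormal_iff_ite]
        rintro ⟨k, rfl | rfl⟩ ⟨l, rfl | rfl⟩ <;>
          simp [hx, hy, hxy, hij.symm, real_inner_comm, Set.domRestrict]
        · exact fun h => hij (congrArg Subtype.val h)
        · exact fun h => hij.symm (congrArg Subtype.val h))
    refine ⟨b, ?_, ?_⟩
    · simpa using hb i (by simp)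
    · simpa [hij.symm] using hb j (by simp)
  have hlin : LinearIndependent ℝ ![a, v] := by
    have : Orthonormal ℝ ![a, v] := by
      rw [orthonormal_iff_ite]
      intro i j
      fin_cases i <;> fin_cases j <;> simp [ha, hv, hav, real_inner_comm]
    exact this.linearIndependent
  have hcard : 2 ≤ Module.finrank ℝ E := by
    simpa using hlin.fintype_card_le_finrank
  have hij : (⟨0, by omega⟩ : Fin (Module.finrank ℝ E)) ≠ ⟨1, by omega⟩ := by simp
  obtain ⟨b, hb0, hb1⟩ := ext a v ha hv hav _ _ hij
  obtain ⟨b', hb0', hb1'⟩ := ext a' v' ha' hv' hav' _ _ hij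
  refine ⟨Unitary.linearIsometryEquiv.symm (b.equiv b' (Equiv.refl _)), ?_, ?_⟩
  · rw [unitary_symm_apply, ← hb0, OrthonormalBasis.equiv_apply_basis, ← hb0']; rfl
  · rw [unitary_symm_apply, ← hb1, OrthonormalBasis.equiv_apply_basis, ← hb1']; rfl

/-- The orthogonal group acts transitively on the unit sphere, by reflections. -/
lemma exists_unitary_map_eq {a a' : E} (h : ‖a‖ = ‖a'‖) :
    ∃ O : unitary (E →L[ℝ] E), O.1 a = a' :=
  ⟨Unitary.linearIsometryEquiv.symm (ℝ ∙ (a - a'))ᗮ.reflection, by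
    rw [unitary_symm_apply, Submodule.reflection_sub h]⟩

variable {μ : Measure (unitary (E →L[ℝ] E))} [μ.IsHaarMeasure] [IsProbabilityMeasure μ]

lemma integral_unitary_pair_eq {a v a' v' : E} (ha : ‖a‖ = 1) (hv : ‖v‖ = 1)
    (hav : inner ℝ a v = 0) (ha' : ‖a'‖ = 1) (hv' : ‖v'‖ = 1) (hav' : inner ℝ a' v' = 0)
    (F : E → E → ℝ) : ∫ O, F (O.1 a') (O.1 v') ∂μ = ∫ O, F (O.1 a) (O.1 v) ∂μ := by
  obtain ⟨g, rfl, rfl⟩ := exists_unitary_map_pair ha hv hav ha' hv' hav'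
  have := isMulRightInvariant_of_compactSpace μ
  exact integral_mul_right_eq_self (μ := μ) (fun O => F (O.1 a) (O.1 v)) g

lemma sum_sq_dual_apply_basis_le {ι : Type*} [Fintype ι] (b : OrthonormalBasis ι ℝ E)
    (ℓ : E →L[ℝ] ℝ) : ∑ i, ℓ (b i) ^ 2 ≤ ‖ℓ‖ ^ 2 := by
  have h := b.sum_sq_norm_inner_left ((InnerProductSpace.toDual ℝ E).symm ℓ)
  simp only [InnerProductSpace.toDual_symm_apply, LinearIsometryEquiv.norm_map,
    Real.norm_eq_abs, sq_abs] at h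
  exact h.le

/-- The vector `(card κ)^{-1/2} ∑ ± b k` attached to a choice of signs. -/
noncomputable def signVector {κ : Type*} [Fintype κ] (b : κ → E) (ε : κ → Bool) : E :=
  (√(Fintype.card κ))⁻¹ • ∑ k, (if ε k then (1 : ℝ) else -1) • b k

omit [FiniteDimensional ℝ E] in
lemma norm_signVector {κ : Type*} [Fintype κ] [Nonempty κ] {b : κ → E} (hb : Orthonormal ℝ b)
    (ε : κ → Bool) : ‖signVector b ε‖ = 1 := by
  have h : ‖signVector b ε‖ ^ 2 = 1 := by
    rw [signVector, norm_smul, mul_pow,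
      ← real_inner_self_eq_norm_sq (∑ k, (if ε k then (1 : ℝ) else -1) • b k), hb.inner_sum]
    have : ∀ k, (starRingEnd ℝ) (if ε k then (1 : ℝ) else -1) * (if ε k then (1 : ℝ) else -1) = 1 :=
      fun k => by split_ifs <;> simp
    simp only [this]
    simp
  nlinarith [norm_nonneg (signVector b ε)]

omit [FiniteDimensional ℝ E] in
lemma inner_signVector_eq_zero {κ : Type*} [Fintype κ] {b : κ → E} {a : E}
    (h : ∀ k, inner ℝ a (b k) = 0) (ε : κ → Bool) : inner ℝ a (signVector b ε) = 0 := by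
  simp only [signVector, inner_smul_right, inner_sum, h, mul_zero, Finset.sum_const_zero]

omit [FiniteDimensional ℝ E] in
/-- A Rademacher average of a linear functional is subgaussian. -/
lemma sum_exp_signVector_le {κ : Type*} [Fintype κ] [DecidableEq κ] (b : κ → E)
    (ℓ : E →L[ℝ] ℝ) (s : ℝ) :
    ∑ ε : κ → Bool, Real.exp (s * ℓ (signVector b ε)) ≤
      2 ^ Fintype.card κ *
        Real.exp (s ^ 2 * (∑ k, ℓ (b k) ^ 2) / (2 * Fintype.card κ)) := by
  set m : ℝ := (Fintype.card κ : ℝ) with hm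
  have hm0 : 0 ≤ m := by positivity
  have h1 (ε : κ → Bool) : Real.exp (s * ℓ (signVector b ε)) =
      ∏ k, Real.exp ((if ε k then (1 : ℝ) else -1) * (s * (√m)⁻¹ * ℓ (b k))) := by
    rw [← Real.exp_sum]
    congr 1
    simp only [signVector, map_smul, map_sum, smul_eq_mul, Finset.mul_sum, ← hm]
    exact Finset.sum_congr rfl fun k _ => by ring
  simp_rw [h1]
  rw [← Fintype.prod_sum
    (fun k (e : Bool) => Real.exp ((if e then (1 : ℝ) else -1) * (s * (√m)⁻¹ * ℓ (b k))))]
  calc _ ≤ ∏ k, (2 * Real.exp ((s * (√m)⁻¹ * ℓ (b k)) ^ 2 / 2)) := by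
        refine Finset.prod_le_prod (fun k _ => by positivity) fun k _ => ?_
        have := Real.cosh_le_exp_half_sq (s * (√m)⁻¹ * ℓ (b k))
        rw [Real.cosh_eq] at this
        simp only [Fintype.sum_bool, if_true, Bool.false_eq_true, if_false, one_mul, neg_one_mul]
        linarith
    _ = _ := by
        rw [Finset.prod_mul_distrib, ← Real.exp_sum, Finset.prod_const, Finset.card_univ]
        congr 2
        rw [Finset.mul_sum, Finset.sum_div]
        refine Finset.sum_congr rfl fun k _ => ?_
        rw [mul_pow, mul_pow, inv_pow, Real.sq_sqrt hm0]
        field_simp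

/-- For a random orthonormal pair `(x, w)`, a linear functional depending on `x` evaluated at `w`
is subgaussian. -/
lemma integral_exp_clm_unitary_pair_le {m : ℕ} (hm : 0 < m) (hE : Module.finrank ℝ E = m + 1)
    {a v : E} (ha : ‖a‖ = 1) (hv : ‖v‖ = 1) (hav : inner ℝ a v = 0)
    {D : E → E →L[ℝ] ℝ} (hD : Continuous D) {L : ℝ} (hL : ∀ x, ‖D x‖ ≤ L) (s : ℝ) :
    ∫ O, Real.exp (s * D (O.1 a) (O.1 v)) ∂μ ≤ Real.exp (s ^ 2 * L ^ 2 / (2 * m)) := by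
  let b := (stdOrthonormalBasis ℝ E).reindex (finCongr hE)
  let c : Fin m → E := fun i => b i.succ
  have hc : Orthonormal ℝ c := b.orthonormal.comp _ (Fin.succ_injective m)
  have : Nonempty (Fin m) := ⟨⟨0, hm⟩⟩
  have hcont (u w : E) : Continuous fun O : unitary (E →L[ℝ] E) =>
      Real.exp (s * D (O.1 u) (O.1 w)) := by
    refine Real.continuous_exp.comp (continuous_const.mul ?_)
    exact (hD.comp (continuous_unitary_apply continuous_id continuous_const)).clm_apply
      (continuous_unitary_apply continuous_id continuous_const)
  have hinv (ε : Fin m → Bool) :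
      ∫ O, Real.exp (s * D (O.1 (b 0)) (O.1 (signVector c ε))) ∂μ =
        ∫ O, Real.exp (s * D (O.1 a) (O.1 v)) ∂μ :=
    integral_unitary_pair_eq ha hv hav (b.orthonormal.1 0) (norm_signVector hc ε)
      (inner_signVector_eq_zero (fun k => b.orthonormal.2 k.succ_ne_zero.symm) ε)
      (fun x y => Real.exp (s * D x y))
  have hsum : ∑ ε : Fin m → Bool,
      ∫ O, Real.exp (s * D (O.1 (b 0)) (O.1 (signVector c ε))) ∂μ ≤
        2 ^ m * Real.exp (s ^ 2 * L ^ 2 / (2 * m)) := by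
    rw [← integral_finsetSum _ fun ε _ => (hcont _ _).integrable_of_compactSpace]
    refine (integral_mono (μ := μ)
      (continuous_finsetSum _ fun ε _ => hcont _ _).integrable_of_compactSpace
      (integrable_const (2 ^ m * Real.exp (s ^ 2 * L ^ 2 / (2 * m)))) fun O => ?_).trans_eq
      (by simp)
    have h := sum_exp_signVector_le c ((D (O.1 (b 0))).comp O.1) s
    rw [Fintype.card_fin] at h
    refine h.trans ?_
    have hbd : ∑ k, ((D (O.1 (b 0))).comp O.1) (c k) ^ 2 ≤ L ^ 2 := by
      calc _ ≤ ∑ i, ((D (O.1 (b 0))).comp O.1) (b i) ^ 2 := by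
            rw [Fin.sum_univ_succ]; exact le_add_of_nonneg_left (sq_nonneg _)
        _ ≤ ‖(D (O.1 (b 0))).comp O.1‖ ^ 2 := sum_sq_dual_apply_basis_le b _
        _ ≤ L ^ 2 := by
            gcongr
            refine ContinuousLinearMap.opNorm_le_bound _ ((norm_nonneg _).trans (hL 0)) fun x => ?_
            rw [ContinuousLinearMap.comp_apply, ← unitary_norm_map O x]
            exact (D _).le_of_opNorm_le (hL _) _
    gcongr
  simp_rw [hinv] at hsum
  rw [Finset.sum_const, Finset.card_univ, Fintype.card_fun, Fintype.card_fin, Fintype.card_bool,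
    nsmul_eq_mul] at hsum
  push_cast at hsum
  exact le_of_mul_le_mul_left hsum (by positivity)

omit [FiniteDimensional ℝ E] in
lemma norm_cos_smul_add_sin_smul {a v : E} (ha : ‖a‖ = 1) (hv : ‖v‖ = 1)
    (hav : inner ℝ a v = 0) (θ : ℝ) : ‖Real.cos θ • a + Real.sin θ • v‖ = 1 := by
  have h : ‖Real.cos θ • a + Real.sin θ • v‖ ^ 2 = 1 := by
    rw [norm_add_sq_real, norm_smul, norm_smul, inner_smul_left, inner_smul_right, hav, ha, hv]
    simp
  nlinarith [norm_nonneg (Real.cos θ • a + Real.sin θ • v)]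

/-- Integrating along a quarter of a great circle: the difference of a smooth Lipschitz function
at the two vectors of a random orthonormal pair is subgaussian. -/
lemma integral_exp_sub_unitary_pair_le {m : ℕ} (hm : 0 < m) (hE : Module.finrank ℝ E = m + 1)
    {a v : E} (ha : ‖a‖ = 1) (hv : ‖v‖ = 1) (hav : inner ℝ a v = 0)
    {f : E → ℝ} (hf : ContDiff ℝ 1 f) {L : ℝ} (hL : ∀ x, ‖fderiv ℝ f x‖ ≤ L) (s : ℝ) :
    ∫ O, Real.exp (s * (f (O.1 v) - f (O.1 a))) ∂μ ≤
      Real.exp ((s * (Real.pi / 2)) ^ 2 * L ^ 2 / (2 * m)) := by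
  set r : ℝ := Real.pi / 2
  let γ : ℝ → E := fun τ => Real.cos (r * τ) • a + Real.sin (r * τ) • v
  let η : ℝ → E := fun τ => -Real.sin (r * τ) • a + Real.cos (r * τ) • v
  have hγη (τ : ℝ) : HasDerivAt γ (r • η τ) τ := by
    have h0 : HasDerivAt (fun τ : ℝ => r * τ) r τ := by
      simpa using (hasDerivAt_id τ).const_mul r
    have h1 := (h0.cos.smul_const a).add (h0.sin.smul_const v)
    refine h1.congr_deriv ?_
    simp only [η]
    module
  have hγc : Continuous γ := by fun_prop
  have hηc : Continuous η := by fun_prop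
  have hγn (τ : ℝ) : ‖γ τ‖ = 1 := norm_cos_smul_add_sin_smul ha hv hav _
  have hηn (τ : ℝ) : ‖η τ‖ = 1 := by
    have := norm_cos_smul_add_sin_smul ha hv hav (r * τ + Real.pi / 2)
    rwa [Real.cos_add_pi_div_two, Real.sin_add_pi_div_two] at this
  have hγη0 (τ : ℝ) : inner ℝ (γ τ) (η τ) = 0 := by
    simp only [γ, η, inner_add_left, inner_add_right, inner_smul_left, inner_smul_right, hav,
      real_inner_comm a v, real_inner_self_eq_norm_sq, ha, hv]
    simp only [conj_trivial]
    ring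
  have hDc : Continuous (fderiv ℝ f) := hf.continuous_fderiv one_ne_zero
  have hL0 : 0 ≤ L := (norm_nonneg _).trans (hL 0)
  let ν : Measure ℝ := volume.restrict (Set.Ioc 0 1)
  have : IsProbabilityMeasure ν := ⟨by simp [ν]⟩
  let Φ : unitary (E →L[ℝ] E) → ℝ → ℝ := fun O τ => r * fderiv ℝ f (O.1 (γ τ)) (O.1 (η τ))
  have hΦc : Continuous (Function.uncurry Φ) := by
    refine continuous_const.mul ((hDc.comp ?_).clm_apply ?_)
    · exact continuous_unitary_apply continuous_fst (hγc.comp continuous_snd)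
    · exact continuous_unitary_apply continuous_fst (hηc.comp continuous_snd)
  have hr : 0 ≤ r := by positivity
  have hΦb (O : unitary (E →L[ℝ] E)) (τ : ℝ) : |Φ O τ| ≤ r * L := by
    rw [abs_mul, abs_of_nonneg hr]
    gcongr
    have := (fderiv ℝ f (O.1 (γ τ))).le_of_opNorm_le (hL _) (O.1 (η τ))
    rwa [unitary_norm_map, hηn, mul_one] at this
  have hexpb (O : unitary (E →L[ℝ] E)) (τ : ℝ) :
      ‖Real.exp (s * Φ O τ)‖ ≤ Real.exp (|s| * (r * L)) := by
    rw [Real.norm_eq_abs, Real.abs_exp, Real.exp_le_exp]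
    refine (le_abs_self _).trans ?_
    rw [abs_mul]
    exact mul_le_mul_of_nonneg_left (hΦb O τ) (abs_nonneg s)
  have hftc (O : unitary (E →L[ℝ] E)) : f (O.1 v) - f (O.1 a) = ∫ τ, Φ O τ ∂ν := by
    have hd (τ : ℝ) : HasDerivAt (fun τ => f (O.1 (γ τ))) (Φ O τ) τ := by
      have h1 : HasDerivAt (fun τ => O.1 (γ τ)) (O.1 (r • η τ)) τ :=
        O.1.hasFDerivAt.comp_hasDerivAt τ (hγη τ)
      have h2 := ((hf.differentiable one_ne_zero) (O.1 (γ τ))).hasFDerivAt.comp_hasDerivAt τ h1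
      simp only [map_smul, smul_eq_mul] at h2
      exact h2
    have h := intervalIntegral.integral_eq_sub_of_hasDerivAt (a := 0) (b := 1)
      (fun τ _ => hd τ)
      ((hΦc.comp (continuous_const.prodMk continuous_id)).intervalIntegrable (μ := volume) 0 1)
    rw [intervalIntegral.integral_of_le zero_le_one] at h
    rw [h]
    simp [γ, r]
  have hjensen (O : unitary (E →L[ℝ] E)) : Real.exp (s * (f (O.1 v) - f (O.1 a))) ≤
      ∫ τ, Real.exp (s * Φ O τ) ∂ν := by
    have hΦO : Continuous (Φ O) := hΦc.comp (continuous_const.prodMk continuous_id)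
    rw [hftc, ← integral_const_mul]
    refine convexOn_exp.map_integral_le Real.continuous_exp.continuousOn isClosed_univ
      (by simp) ?_ ?_
    · exact (Integrable.of_bound hΦO.aestronglyMeasurable (r * L)
        (ae_of_all _ fun τ => hΦb O τ)).const_mul s
    · exact Integrable.of_bound
        (Real.continuous_exp.comp (continuous_const.mul hΦO)).aestronglyMeasurable
        (Real.exp (|s| * (r * L))) (ae_of_all _ fun τ => hexpb O τ)
  have hint : Integrable (Function.uncurry fun O τ => Real.exp (s * Φ O τ)) (μ.prod ν) :=
    Integrable.of_bound
      (Real.continuous_exp.comp (continuous_const.mul hΦc)).aestronglyMeasurable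
      (Real.exp (|s| * (r * L))) (ae_of_all _ fun p => hexpb p.1 p.2)
  have hfc (w : E) : Continuous fun O : unitary (E →L[ℝ] E) => f (O.1 w) :=
    hf.continuous.comp (continuous_unitary_apply continuous_id continuous_const)
  calc ∫ O, Real.exp (s * (f (O.1 v) - f (O.1 a))) ∂μ
      ≤ ∫ O, ∫ τ, Real.exp (s * Φ O τ) ∂ν ∂μ :=
        integral_mono (Real.continuous_exp.comp
          (continuous_const.mul ((hfc v).sub (hfc a)))).integrable_of_compactSpace
          hint.integral_prod_left hjensen
    _ = ∫ τ, ∫ O, Real.exp (s * Φ O τ) ∂μ ∂ν := integral_integral_swap hint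
    _ ≤ ∫ _, Real.exp ((s * r) ^ 2 * L ^ 2 / (2 * m)) ∂ν := by
        refine integral_mono hint.integral_prod_right (integrable_const _) fun τ => ?_
        have := integral_exp_clm_unitary_pair_le (μ := μ) hm hE (hγn τ) (hηn τ) (hγη0 τ) hDc hL
          (s * r)
        simpa only [Φ, mul_assoc] using this
    _ = _ := by simp

instance compactSpace_stabilizer (a : E) :
    CompactSpace (MulAction.stabilizer (unitary (E →L[ℝ] E)) a) := by
  have : IsClosed {k : unitary (E →L[ℝ] E) | k.1 a = a} :=
    isClosed_eq (continuous_unitary_apply continuous_id continuous_const) continuous_const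
  exact isCompact_iff_compactSpace.mp this.isCompact

lemma stabilizer_apply {a : E} (k : MulAction.stabilizer (unitary (E →L[ℝ] E)) a) :
    k.1.1 a = a := k.2

lemma exists_orthonormalBasis_apply_zero {m : ℕ} (hE : Module.finrank ℝ E = m + 1) {a : E}
    (ha : ‖a‖ = 1) : ∃ b : OrthonormalBasis (Fin (m + 1)) ℝ E, b 0 = a := by
  let b := (stdOrthonormalBasis ℝ E).reindex (finCongr hE)
  obtain ⟨O, hO⟩ := exists_unitary_map_eq (a := b 0) (a' := a) (by rw [b.orthonormal.1, ha])
  exact ⟨b.map (Unitary.linearIsometryEquiv O), hO⟩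

omit [FiniteDimensional ℝ E] in
lemma norm_reflection_orthogonal_sub (u z : E) :
    ‖(ℝ ∙ u)ᗮ.reflection z - z‖ = 2 * |inner ℝ (‖u‖⁻¹ • u) z| := by
  have h : (ℝ ∙ u)ᗮ.reflection z - z = (-(2 * (inner ℝ u z / ‖u‖ ^ 2))) • u := by
    rw [Submodule.reflection_orthogonal_apply, Submodule.reflection_singleton_apply,
      RCLike.ofReal_real_eq_id, id_eq]
    module
  rw [h, norm_smul, real_inner_smul_left, norm_neg, Real.norm_eq_abs, abs_mul, abs_mul, abs_div,
    abs_pow, abs_inv, abs_norm, abs_two]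
  rcases eq_or_ne u 0 with rfl | hu
  · simp
  · field_simp

section Stabilizer

variable {a v : E} {ν : Measure (MulAction.stabilizer (unitary (E →L[ℝ] E)) a)}
  [ν.IsHaarMeasure] [IsProbabilityMeasure ν]

lemma continuous_stabilizer_apply {X : Type*} [TopologicalSpace X]
    {g : X → MulAction.stabilizer (unitary (E →L[ℝ] E)) a} (hg : Continuous g) (v : E) :
    Continuous fun x => (g x).1.1 v :=
  continuous_unitary_apply (continuous_subtype_val.comp hg) continuous_const

lemma integral_sq_inner_stabilizer_le {m : ℕ} (hm : 0 < m) (hE : Module.finrank ℝ E = m + 1)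
    (ha : ‖a‖ = 1) (hv : ‖v‖ = 1) (hav : inner ℝ a v = 0) {w : E} (hw : ‖w‖ = 1) :
    ∫ k, inner ℝ w (k.1.1 v) ^ 2 ∂ν ≤ 1 / m := by
  obtain ⟨b, hb⟩ := exists_orthonormalBasis_apply_zero hE ha
  have := isMulRightInvariant_of_compactSpace ν
  have hinv (j : Fin m) :
      ∫ k, inner ℝ w (k.1.1 (b j.succ)) ^ 2 ∂ν = ∫ k, inner ℝ w (k.1.1 v) ^ 2 ∂ν := by
    obtain ⟨h, hha, hhv⟩ := exists_unitary_map_pair ha hv hav ha (b.orthonormal.1 j.succ)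
      (by rw [← hb]; exact b.orthonormal.2 j.succ_ne_zero.symm)
    rw [← hhv]
    exact integral_mul_right_eq_self (μ := ν) (fun k => inner ℝ w (k.1.1 v) ^ 2) ⟨h, hha⟩
  have hcont (x : E) : Continuous fun k : MulAction.stabilizer (unitary (E →L[ℝ] E)) a =>
      inner ℝ w (k.1.1 x) ^ 2 :=
    (continuous_const.inner (continuous_stabilizer_apply continuous_id x)).pow 2
  have hsum : ∑ j : Fin m, ∫ k, inner ℝ w (k.1.1 (b j.succ)) ^ 2 ∂ν ≤ 1 := by
    rw [← integral_finsetSum _ fun j _ => (hcont _).integrable_of_compactSpace]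
    refine (integral_mono (μ := ν)
      (continuous_finsetSum _ fun j _ => hcont _).integrable_of_compactSpace
      (integrable_const 1) fun k => ?_).trans_eq (by simp)
    have h := sum_sq_dual_apply_basis_le b ((innerSL ℝ w).comp k.1.1)
    rw [Fin.sum_univ_succ] at h
    have hn : ‖(innerSL ℝ w).comp k.1.1‖ ≤ 1 := by
      refine ContinuousLinearMap.opNorm_le_bound _ zero_le_one fun x => ?_
      rw [← unitary_norm_map k.1 x, ← hw]
      exact norm_inner_le_norm w (k.1.1 x)
    have hn2 := pow_le_one₀ (norm_nonneg _) hn (n := 2)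
    have := sq_nonneg (((innerSL ℝ w).comp k.1.1) (b 0))
    simp only [ContinuousLinearMap.comp_apply, innerSL_apply_apply] at h this ⊢
    linarith
  simp_rw [hinv] at hsum
  rw [Finset.sum_const, Finset.card_univ, Fintype.card_fin, nsmul_eq_mul] at hsum
  rw [le_div_iff₀ (by positivity)]
  linarith

lemma integral_abs_inner_stabilizer_le {m : ℕ} (hm : 0 < m) (hE : Module.finrank ℝ E = m + 1)
    (ha : ‖a‖ = 1) (hv : ‖v‖ = 1) (hav : inner ℝ a v = 0) {w : E} (hw : ‖w‖ = 1) :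
    ∫ k, |inner ℝ w (k.1.1 v)| ∂ν ≤ 1 / √m := by
  have hs : 0 < √(m : ℝ) := by positivity
  have hs2 : √(m : ℝ) ^ 2 = m := Real.sq_sqrt (by positivity)
  have hcont : Continuous fun k : MulAction.stabilizer (unitary (E →L[ℝ] E)) a =>
      inner ℝ w (k.1.1 v) :=
    continuous_const.inner (continuous_stabilizer_apply continuous_id v)
  calc ∫ k, |inner ℝ w (k.1.1 v)| ∂ν
      ≤ ∫ k, (√m / 2 * inner ℝ w (k.1.1 v) ^ 2 + 1 / (2 * √m)) ∂ν := by
        refine integral_mono hcont.abs.integrable_of_compactSpace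
          ((continuous_const.mul (hcont.pow 2)).add continuous_const).integrable_of_compactSpace
          fun k => ?_
        have h : 0 ≤ (√m * |inner ℝ w (k.1.1 v)| - 1) ^ 2 / (2 * √m) := by positivity
        have h2 : (√m * |inner ℝ w (k.1.1 v)| - 1) ^ 2 / (2 * √m) =
            √m / 2 * |inner ℝ w (k.1.1 v)| ^ 2 + 1 / (2 * √m) - |inner ℝ w (k.1.1 v)| := by
          field_simp
          ring
        rw [h2, sq_abs] at h
        exact sub_nonneg.mp h
    _ = √m / 2 * ∫ k, inner ℝ w (k.1.1 v) ^ 2 ∂ν + 1 / (2 * √m) := by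
        have hi : Integrable (fun k => inner ℝ w (k.1.1 v) ^ 2) ν :=
          (hcont.pow 2).integrable_of_compactSpace
        rw [integral_add (hi.const_mul _) (integrable_const _), integral_const_mul]
        simp
    _ ≤ √m / 2 * (1 / m) + 1 / (2 * √m) := by
        gcongr
        exact integral_sq_inner_stabilizer_le hm hE ha hv hav hw
    _ = 1 / √m := by
        rw [show (1 : ℝ) / m = 1 / √m ^ 2 by rw [hs2]]
        field_simp
        norm_num

variable (ν v) in
/-- The mean of `f` over the equator orthogonal to `O a`. -/
noncomputable def equatorMean (f : E → ℝ) (O : unitary (E →L[ℝ] E)) : ℝ :=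
  ∫ k, f (O.1 (k.1.1 v)) ∂ν

omit [IsProbabilityMeasure ν] in
lemma equatorMean_eq_of_apply_eq (f : E → ℝ) {O O' : unitary (E →L[ℝ] E)}
    (h : O.1 a = O'.1 a) : equatorMean v ν f O = equatorMean v ν f O' := by
  have hmem : O'⁻¹ * O ∈ MulAction.stabilizer (unitary (E →L[ℝ] E)) a := by
    change (O'⁻¹ * O).1 a = a
    rw [unitary_mul_apply, h, ← unitary_mul_apply, inv_mul_cancel]
    rfl
  have := integral_mul_left_eq_self (μ := ν) (fun k => f (O'.1 (k.1.1 v))) ⟨_, hmem⟩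
  rw [equatorMean, equatorMean, ← this]
  congr 1 with k
  rw [Subgroup.coe_mul, ← unitary_mul_apply, ← unitary_mul_apply]
  simp only [← mul_assoc, mul_inv_cancel, one_mul]

lemma abs_equatorMean_sub_le {m : ℕ} (hm : 0 < m) (hE : Module.finrank ℝ E = m + 1)
    (ha : ‖a‖ = 1) (hv : ‖v‖ = 1) (hav : inner ℝ a v = 0) {f : E → ℝ} {K : NNReal}
    (hf : LipschitzWith K f) (O O' : unitary (E →L[ℝ] E)) :
    |equatorMean v ν f O - equatorMean v ν f O'| ≤ 2 * K / √m := by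
  by_cases hu : O.1 a - O'.1 a = 0
  · rw [equatorMean_eq_of_apply_eq f (sub_eq_zero.mp hu), sub_self, abs_zero]
    positivity
  set u := O.1 a - O'.1 a with hu_def
  let R : unitary (E →L[ℝ] E) := Unitary.linearIsometryEquiv.symm (ℝ ∙ u)ᗮ.reflection
  have hR : (R * O).1 a = O'.1 a := by
    rw [unitary_mul_apply, unitary_symm_apply, hu_def,
      Submodule.reflection_sub (by simp only [unitary_norm_map])]
  rw [← equatorMean_eq_of_apply_eq f hR, abs_sub_comm]
  have hfc (P : unitary (E →L[ℝ] E)) :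
      Continuous fun k : MulAction.stabilizer (unitary (E →L[ℝ] E)) a => f (P.1 (k.1.1 v)) :=
    hf.continuous.comp (P.1.continuous.comp (continuous_stabilizer_apply continuous_id v))
  let w : E := (O⁻¹).1 (‖u‖⁻¹ • u)
  have hw : ‖w‖ = 1 := by
    rw [unitary_norm_map, norm_smul, norm_inv, norm_norm, inv_mul_cancel₀ (norm_ne_zero_iff.mpr hu)]
  have hOw : O.1 w = ‖u‖⁻¹ • u := by
    rw [← unitary_mul_apply, mul_inv_cancel]
    rfl
  have hcont : Continuous fun k : MulAction.stabilizer (unitary (E →L[ℝ] E)) a =>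
      |inner ℝ w (k.1.1 v)| :=
    (continuous_const.inner (continuous_stabilizer_apply continuous_id v)).abs
  calc |equatorMean v ν f (R * O) - equatorMean v ν f O|
      = |∫ k, (f ((R * O).1 (k.1.1 v)) - f (O.1 (k.1.1 v))) ∂ν| := by
        rw [integral_sub (hfc _).integrable_of_compactSpace (hfc _).integrable_of_compactSpace]
        rfl
    _ ≤ ∫ k, |f ((R * O).1 (k.1.1 v)) - f (O.1 (k.1.1 v))| ∂ν := abs_integral_le_integral_abs
    _ ≤ ∫ k, K * (2 * |inner ℝ w (k.1.1 v)|) ∂ν := by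
        refine integral_mono ((hfc _).sub (hfc _)).abs.integrable_of_compactSpace
          (continuous_const.mul (continuous_const.mul hcont)).integrable_of_compactSpace
          fun k => ?_
        have h := hf.dist_le_mul ((R * O).1 (k.1.1 v)) (O.1 (k.1.1 v))
        rw [Real.dist_eq, dist_eq_norm, unitary_mul_apply, unitary_symm_apply,
          norm_reflection_orthogonal_sub, ← hOw, unitary_inner_map] at h
        exact h
    _ = K * (2 * ∫ k, |inner ℝ w (k.1.1 v)| ∂ν) := by
        rw [integral_const_mul, integral_const_mul]
    _ ≤ K * (2 * (1 / √m)) := by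
        gcongr
        exact integral_abs_inner_stabilizer_le hm hE ha hv hav hw
    _ = 2 * K / √m := by ring

omit [μ.IsHaarMeasure] [ν.IsHaarMeasure] in
lemma integrable_equatorMean_prod {f : E → ℝ} (hf : Continuous f) (v : E)
    (g : ℝ → ℝ → ℝ) (hg : Continuous (Function.uncurry g)) :
    Integrable (Function.uncurry fun O k => g (f (O.1 a)) (f (O.1 (k.1.1 v)))) (μ.prod ν) := by
  refine Continuous.integrable_of_compactSpace (hg.comp (.prodMk (hf.comp ?_) (hf.comp ?_)))
  · exact continuous_unitary_apply continuous_fst continuous_const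
  · exact continuous_unitary_apply continuous_fst (continuous_stabilizer_apply continuous_snd v)

omit [ν.IsHaarMeasure] in
lemma continuous_equatorMean {f : E → ℝ} (hf : Continuous f) :
    Continuous (equatorMean v ν f) := by
  have h : Continuous (Function.uncurry
      fun (O : unitary (E →L[ℝ] E)) (k : MulAction.stabilizer (unitary (E →L[ℝ] E)) a) =>
        f (O.1 (k.1.1 v))) :=
    hf.comp (continuous_unitary_apply continuous_fst
      (continuous_stabilizer_apply continuous_snd v))
  have hc := continuous_parametric_integral_of_continuous (μ := ν) h isCompact_univ
  rwa [Measure.restrict_univ] at hc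

lemma integral_unitary_apply_eq {a a' : E} (h : ‖a‖ = ‖a'‖) (F : E → ℝ) :
    ∫ O, F (O.1 a') ∂μ = ∫ O, F (O.1 a) ∂μ := by
  obtain ⟨g, rfl⟩ := exists_unitary_map_eq h
  have := isMulRightInvariant_of_compactSpace μ
  exact integral_mul_right_eq_self (μ := μ) (fun O => F (O.1 a)) g

lemma integral_equatorMean (ha : ‖a‖ = 1) (hv : ‖v‖ = 1) {f : E → ℝ} (hf : Continuous f) :
    ∫ O, equatorMean v ν f O ∂μ = ∫ O, f (O.1 a) ∂μ := by
  have hk (k : MulAction.stabilizer (unitary (E →L[ℝ] E)) a) :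
      ∫ O, f (O.1 (k.1.1 v)) ∂μ = ∫ O, f (O.1 a) ∂μ :=
    integral_unitary_apply_eq (by rw [unitary_norm_map, ha, hv]) f
  calc _ = ∫ k, ∫ O, f (O.1 (k.1.1 v)) ∂μ ∂ν :=
        integral_integral_swap (integrable_equatorMean_prod hf v (fun _ y => y) continuous_snd)
    _ = _ := by simp [hk]

lemma abs_equatorMean_sub_integral_le {m : ℕ} (hm : 0 < m)
    (hE : Module.finrank ℝ E = m + 1) (ha : ‖a‖ = 1) (hv : ‖v‖ = 1) (hav : inner ℝ a v = 0)
    {f : E → ℝ} {K : NNReal} (hf : LipschitzWith K f) (O : unitary (E →L[ℝ] E)) :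
    |equatorMean v ν f O - ∫ P, f (P.1 a) ∂μ| ≤ 2 * K / √m := by
  rw [← integral_equatorMean (μ := μ) (ν := ν) ha hv hf.continuous]
  have hi : Integrable (equatorMean v ν f) μ :=
    (continuous_equatorMean hf.continuous).integrable_of_compactSpace
  have h : equatorMean v ν f O - ∫ P, equatorMean v ν f P ∂μ =
      ∫ P, (equatorMean v ν f O - equatorMean v ν f P) ∂μ := by
    rw [integral_sub (integrable_const _) hi]
    simp
  rw [h]
  refine abs_integral_le_integral_abs.trans ?_
  refine (integral_mono ((integrable_const _).sub hi).abs (integrable_const (2 * K / √m))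
    fun P => ?_).trans_eq (by simp)
  exact abs_equatorMean_sub_le hm hE ha hv hav hf O P

lemma integral_exp_sub_equatorMean_le {m : ℕ} (hm : 0 < m) (hE : Module.finrank ℝ E = m + 1)
    (ha : ‖a‖ = 1) (hv : ‖v‖ = 1) (hav : inner ℝ a v = 0) {f : E → ℝ} (hf : ContDiff ℝ 1 f)
    {L : ℝ} (hL : ∀ x, ‖fderiv ℝ f x‖ ≤ L) (s : ℝ) :
    ∫ O, Real.exp (s * (f (O.1 a) - equatorMean v ν f O)) ∂μ ≤
      Real.exp ((s * (Real.pi / 2)) ^ 2 * L ^ 2 / (2 * m)) := by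
  have hint := integrable_equatorMean_prod (μ := μ) (ν := ν) hf.continuous v
    (fun x y => Real.exp (s * (x - y))) (by fun_prop)
  have hfc (O : unitary (E →L[ℝ] E)) :
      Continuous fun k : MulAction.stabilizer (unitary (E →L[ℝ] E)) a => f (O.1 (k.1.1 v)) :=
    hf.continuous.comp (O.1.continuous.comp (continuous_stabilizer_apply continuous_id v))
  have hjensen (O : unitary (E →L[ℝ] E)) :
      Real.exp (s * (f (O.1 a) - equatorMean v ν f O)) ≤
        ∫ k, Real.exp (s * (f (O.1 a) - f (O.1 (k.1.1 v)))) ∂ν := by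
    have h : s * (f (O.1 a) - equatorMean v ν f O) =
        ∫ k, s * (f (O.1 a) - f (O.1 (k.1.1 v))) ∂ν := by
      rw [integral_const_mul, integral_sub (integrable_const _)
        (hfc O).integrable_of_compactSpace]
      simp [equatorMean]
    rw [h]
    have hc : Continuous fun k : MulAction.stabilizer (unitary (E →L[ℝ] E)) a =>
        s * (f (O.1 a) - f (O.1 (k.1.1 v))) :=
      continuous_const.mul (continuous_const.sub (hfc O))
    exact convexOn_exp.map_integral_le Real.continuous_exp.continuousOn isClosed_univ
      (by simp) hc.integrable_of_compactSpace
      (Real.continuous_exp.comp hc).integrable_of_compactSpace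
  have hk (k : MulAction.stabilizer (unitary (E →L[ℝ] E)) a) :
      ∫ O, Real.exp (s * (f (O.1 a) - f (O.1 (k.1.1 v)))) ∂μ ≤
        Real.exp ((s * (Real.pi / 2)) ^ 2 * L ^ 2 / (2 * m)) := by
    have h1 : inner ℝ (k.1.1 v) a = 0 := by
      have := unitary_inner_map k.1 v a
      rwa [stabilizer_apply, real_inner_comm a v, hav] at this
    exact integral_exp_sub_unitary_pair_le hm hE (by rw [unitary_norm_map, hv]) ha h1 hf hL s
  have hT : Continuous fun O => Real.exp (s * (f (O.1 a) - equatorMean v ν f O)) :=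
    Real.continuous_exp.comp (continuous_const.mul ((hf.continuous.comp
      (continuous_unitary_apply continuous_id continuous_const)).sub
        (continuous_equatorMean hf.continuous)))
  calc _ ≤ ∫ O, ∫ k, Real.exp (s * (f (O.1 a) - f (O.1 (k.1.1 v)))) ∂ν ∂μ :=
        integral_mono hT.integrable_of_compactSpace hint.integral_prod_left hjensen
    _ = ∫ k, ∫ O, Real.exp (s * (f (O.1 a) - f (O.1 (k.1.1 v)))) ∂μ ∂ν :=
        integral_integral_swap hint
    _ ≤ ∫ _, Real.exp ((s * (Real.pi / 2)) ^ 2 * L ^ 2 / (2 * m)) ∂ν :=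
        integral_mono hint.integral_prod_right (integrable_const _) hk
    _ = _ := by simp

end Stabilizer

lemma exists_norm_eq_one_inner_eq_zero {m : ℕ} (hm : 0 < m) (hE : Module.finrank ℝ E = m + 1)
    {a : E} (ha : ‖a‖ = 1) : ∃ v : E, ‖v‖ = 1 ∧ inner ℝ a v = 0 := by
  obtain ⟨b, rfl⟩ := exists_orthonormalBasis_apply_zero hE ha
  have : NeZero m := ⟨hm.ne'⟩
  exact ⟨b (Fin.succ 0), b.orthonormal.1 _, b.orthonormal.2 (Fin.succ_ne_zero 0).symm⟩

/-- Exponential moment bound for smooth Lipschitz functions on the sphere. -/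
lemma integral_exp_sub_integral_le {m : ℕ} (hm : 0 < m) (hE : Module.finrank ℝ E = m + 1)
    {a : E} (ha : ‖a‖ = 1) {f : E → ℝ} (hf : ContDiff ℝ 1 f) {K : NNReal}
    (hK : LipschitzWith K f) (s : ℝ) :
    ∫ O, Real.exp (s * (f (O.1 a) - ∫ P, f (P.1 a) ∂μ)) ∂μ ≤
      Real.exp (|s| * (2 * K / √m) + (s * (Real.pi / 2)) ^ 2 * K ^ 2 / (2 * m)) := by
  obtain ⟨v, hv, hav⟩ := exists_norm_eq_one_inner_eq_zero hm hE ha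
  obtain ⟨ν, _, _⟩ := exists_isHaarMeasure_isProbabilityMeasure
    (MulAction.stabilizer (unitary (E →L[ℝ] E)) a)
  have hfc : Continuous fun O : unitary (E →L[ℝ] E) => f (O.1 a) :=
    hf.continuous.comp (continuous_unitary_apply continuous_id continuous_const)
  have hT : Continuous fun O => Real.exp (s * (f (O.1 a) - equatorMean v ν f O)) :=
    Real.continuous_exp.comp (continuous_const.mul (hfc.sub (continuous_equatorMean hf.continuous)))
  have hpt (O : unitary (E →L[ℝ] E)) : Real.exp (s * (f (O.1 a) - ∫ P, f (P.1 a) ∂μ)) ≤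
      Real.exp (|s| * (2 * K / √m)) * Real.exp (s * (f (O.1 a) - equatorMean v ν f O)) := by
    rw [← Real.exp_add, Real.exp_le_exp]
    have h := mul_le_mul_of_nonneg_left
      (abs_equatorMean_sub_integral_le (μ := μ) (ν := ν) hm hE ha hv hav hK O) (abs_nonneg s)
    rw [← abs_mul] at h
    linarith [le_abs_self (s * (equatorMean v ν f O - ∫ P, f (P.1 a) ∂μ))]
  rw [Real.exp_add]
  calc _ ≤ ∫ O, Real.exp (|s| * (2 * K / √m)) *
          Real.exp (s * (f (O.1 a) - equatorMean v ν f O)) ∂μ :=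
        integral_mono (Real.continuous_exp.comp
          (continuous_const.mul (hfc.sub continuous_const))).integrable_of_compactSpace
          (hT.integrable_of_compactSpace.const_mul _) hpt
    _ ≤ _ := by
        rw [integral_const_mul]
        gcongr
        exact integral_exp_sub_equatorMean_le hm hE ha hv hav hf
          (fun x => norm_fderiv_le_of_lipschitz ℝ hK) s

lemma measureReal_le_sub_integral_le {m : ℕ} (hm : 0 < m) (hE : Module.finrank ℝ E = m + 1)
    {a : E} (ha : ‖a‖ = 1) {f : E → ℝ} (hf : ContDiff ℝ 1 f) {K : NNReal} (hK0 : 0 < K)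
    (hK : LipschitzWith K f) {t : ℝ} (ht : 4 * (K / √m) ≤ t) :
    μ.real {O | t ≤ f (O.1 a) - ∫ P, f (P.1 a) ∂μ} ≤ Real.exp (-(m * t ^ 2 / (32 * K ^ 2))) := by
  have hfc : Continuous fun O : unitary (E →L[ℝ] E) => f (O.1 a) :=
    hf.continuous.comp (continuous_unitary_apply continuous_id continuous_const)
  have hm' : (0 : ℝ) < √m := by positivity
  have hK' : (0 : ℝ) < K := hK0
  set σ : ℝ := K / √m with hσ
  have hσ0 : 0 < σ := by positivity
  have hσ2 : σ ^ 2 = K ^ 2 / m := by rw [hσ, div_pow, Real.sq_sqrt (by positivity)]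
  set s : ℝ := (t - 2 * σ) / (4 * σ ^ 2) with hs
  have hs0 : 0 ≤ s := div_nonneg (by linarith) (by positivity)
  refine (ProbabilityTheory.measure_ge_le_exp_mul_mgf t hs0 (Real.continuous_exp.comp
    (continuous_const.mul (hfc.sub continuous_const))).integrable_of_compactSpace).trans ?_
  refine (mul_le_mul_of_nonneg_left (integral_exp_sub_integral_le hm hE ha hf hK s)
    (Real.exp_nonneg _)).trans ?_
  rw [← Real.exp_add, Real.exp_le_exp, abs_of_nonneg hs0]
  have h1 : (s * (Real.pi / 2)) ^ 2 * K ^ 2 / (2 * m) ≤ 2 * (s * σ) ^ 2 := by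
    have h2 : (s * (Real.pi / 2)) ^ 2 * K ^ 2 / (2 * m) = Real.pi ^ 2 / 8 * (s * σ) ^ 2 := by
      rw [mul_pow s σ, hσ2]
      ring
    rw [h2]
    gcongr
    nlinarith [Real.pi_le_four, Real.pi_pos]
  have h3 : (m : ℝ) * t ^ 2 / (32 * K ^ 2) = t ^ 2 / (32 * σ ^ 2) := by
    rw [hσ2]
    field_simp
  have h4 : -s * t + (s * (2 * σ) + 2 * (s * σ) ^ 2) = -((t - 2 * σ) ^ 2 / (8 * σ ^ 2)) := by
    rw [hs]
    field_simp
    ring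
  have h5 : t ^ 2 / (32 * σ ^ 2) ≤ (t - 2 * σ) ^ 2 / (8 * σ ^ 2) := by
    rw [div_le_div_iff₀ (by positivity) (by positivity)]
    have : t ^ 2 ≤ 4 * (t - 2 * σ) ^ 2 := by nlinarith
    nlinarith [sq_nonneg σ]
  have h6 : (2 : ℝ) * K / √m = 2 * σ := by rw [hσ]; ring
  rw [h6, h3]
  linarith

lemma measureReal_le_abs_sub_integral_le_of_contDiff {m : ℕ} (hm : 0 < m)
    (hE : Module.finrank ℝ E = m + 1) {a : E} (ha : ‖a‖ = 1) {f : E → ℝ} (hf : ContDiff ℝ 1 f)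
    {K : NNReal} (hK0 : 0 < K) (hK : LipschitzWith K f) {t : ℝ} (ht : 0 ≤ t) :
    μ.real {O | t ≤ |f (O.1 a) - ∫ P, f (P.1 a) ∂μ|} ≤
      2 * Real.exp (-(1 / 64 * ((m + 1 : ℕ) : ℝ) * t ^ 2) / K ^ 2) := by
  have hm1 : (1 : ℝ) ≤ m := by exact_mod_cast hm
  have hm' : (0 : ℝ) < √m := by positivity
  have hK' : (0 : ℝ) < K := hK0
  have hexp : -(m * t ^ 2 / (32 * K ^ 2)) ≤
      -(1 / 64 * ((m + 1 : ℕ) : ℝ) * t ^ 2) / (K : ℝ) ^ 2 := by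
    rw [neg_div, neg_le_neg_iff, div_le_div_iff₀ (by positivity) (by positivity)]
    push_cast
    have : 0 ≤ t ^ 2 * (K : ℝ) ^ 2 := by positivity
    nlinarith
  rcases le_or_gt (4 * (K / √m)) t with h | h
  · have h1 := measureReal_le_sub_integral_le (μ := μ) hm hE ha hf hK0 hK h
    have h2 := measureReal_le_sub_integral_le (μ := μ) hm hE ha hf.neg hK0 hK.neg h
    have hsub : {O : unitary (E →L[ℝ] E) | t ≤ |f (O.1 a) - ∫ P, f (P.1 a) ∂μ|} ⊆
        {O | t ≤ f (O.1 a) - ∫ P, f (P.1 a) ∂μ} ∪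
          {O | t ≤ -f (O.1 a) - ∫ P, -f (P.1 a) ∂μ} := by
      intro O hO
      have hO : t ≤ |f (O.1 a) - ∫ P, f (P.1 a) ∂μ| := hO
      rcases le_abs.mp hO with h | h
      · exact Or.inl h
      · refine Or.inr ?_
        rw [Set.mem_ofPred_eq, integral_neg]
        linarith
    calc _ ≤ _ := measureReal_mono hsub
      _ ≤ _ := measureReal_union_le _ _
      _ ≤ _ := add_le_add h1 h2
      _ = 2 * Real.exp (-(m * t ^ 2 / (32 * K ^ 2))) := by ring
      _ ≤ _ := by gcongr
  · refine measureReal_le_one.trans ?_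
    have h1 : m * t ^ 2 / (32 * (K : ℝ) ^ 2) ≤ 1 / 2 := by
      rw [div_le_iff₀ (by positivity)]
      have h2 : t * √m ≤ 4 * K := by
        rw [← mul_div_assoc, lt_div_iff₀ hm'] at h
        exact h.le
      have h3 := pow_le_pow_left₀ (by positivity) h2 2
      rw [mul_pow, Real.sq_sqrt (by positivity)] at h3
      linarith
    have h2 := Real.add_one_le_exp (-(1 / 64 * ((m + 1 : ℕ) : ℝ) * t ^ 2) / (K : ℝ) ^ 2)
    linarith

lemma LipschitzWith.exists_contDiff_dist_le {f : E → ℝ} {K : NNReal} (hf : LipschitzWith K f)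
    {δ : ℝ} (hδ : 0 < δ) :
    ∃ g : E → ℝ, ContDiff ℝ 1 g ∧ LipschitzWith K g ∧ ∀ x, |g x - f x| ≤ K * δ := by
  borelize E
  let κ : Measure E := Measure.addHaar
  let φ : ContDiffBump (0 : E) := ⟨δ / 2, δ, half_pos hδ, half_lt_self hδ⟩
  let g : E → ℝ := convolution (φ.normed κ) f (ContinuousLinearMap.lsmul ℝ ℝ) κ
  have hint (x : E) : Integrable (fun y => φ.normed κ y * f (x - y)) κ :=
    (φ.continuous_normed.mul
      (hf.continuous.comp (continuous_const.sub continuous_id))).integrable_of_hasCompactSupport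
      φ.hasCompactSupport_normed.mul_right
  refine ⟨g, φ.hasCompactSupport_normed.contDiff_convolution_left _ φ.contDiff_normed
    (hf.continuous.locallyIntegrable), LipschitzWith.of_dist_le_mul fun x x' => ?_, fun x => ?_⟩
  · have hg (z : E) : g z = ∫ y, φ.normed κ y * f (z - y) ∂κ := rfl
    rw [Real.dist_eq, hg, hg, ← integral_sub (hint x) (hint x')]
    refine abs_integral_le_integral_abs.trans ?_
    calc _ ≤ ∫ y, φ.normed κ y * (K * dist x x') ∂κ := by
          refine integral_mono ((hint x).sub (hint x')).abs (φ.integrable_normed.mul_const _)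
            fun y => ?_
          simp only [← mul_sub, abs_mul, abs_of_nonneg (φ.nonneg_normed y)]
          refine mul_le_mul_of_nonneg_left ?_ (φ.nonneg_normed y)
          simpa [Real.dist_eq] using hf.dist_le_mul (x - y) (x' - y)
      _ = _ := by rw [integral_mul_const, φ.integral_normed, one_mul]
  · refine φ.dist_normed_convolution_le hf.continuous.aestronglyMeasurable fun y hy => ?_
    refine (hf.dist_le_mul y x).trans ?_
    gcongr
    exact (Metric.mem_ball.mp hy).le

/-- Lévy's inequality for the Haar measure on the orthogonal group. -/
lemma measureReal_le_abs_sub_integral_le {m : ℕ} (hm : 0 < m)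
    (hE : Module.finrank ℝ E = m + 1) {a : E} (ha : ‖a‖ = 1) {f : E → ℝ} {K : NNReal}
    (hK0 : 0 < K) (hK : LipschitzWith K f) {t : ℝ} (ht : 0 < t) :
    μ.real {O | t ≤ |f (O.1 a) - ∫ P, f (P.1 a) ∂μ|} ≤
      2 * Real.exp (-(1 / 64 * ((m + 1 : ℕ) : ℝ) * t ^ 2) / K ^ 2) := by
  have hK' : (0 : ℝ) < K := hK0
  have hint {h : E → ℝ} (hh : Continuous h) : Integrable (fun O => h (O.1 a)) μ :=
    (hh.comp (continuous_unitary_apply continuous_id continuous_const)).integrable_of_compactSpace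
  have hbound (u : ℝ) (hu : u ∈ Set.Ioo 0 t) :
      μ.real {O | t ≤ |f (O.1 a) - ∫ P, f (P.1 a) ∂μ|} ≤
        2 * Real.exp (-(1 / 64 * ((m + 1 : ℕ) : ℝ) * (t - u) ^ 2) / K ^ 2) := by
    obtain ⟨g, hg, hgK, hgf⟩ := hK.exists_contDiff_dist_le (δ := u / (2 * K))
      (div_pos hu.1 (by positivity))
    have hKu : K * (u / (2 * K)) = u / 2 := by field_simp
    rw [hKu] at hgf
    have hmean : |∫ P, g (P.1 a) ∂μ - ∫ P, f (P.1 a) ∂μ| ≤ u / 2 := by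
      rw [← integral_sub (hint hg.continuous) (hint hK.continuous)]
      refine abs_integral_le_integral_abs.trans ?_
      exact (integral_mono ((hint hg.continuous).sub (hint hK.continuous)).abs
        (integrable_const (u / 2)) fun P => hgf _).trans_eq (by simp)
    refine (measureReal_mono ?_).trans (measureReal_le_abs_sub_integral_le_of_contDiff
      (μ := μ) hm hE ha hg hK0 hgK (sub_nonneg.mpr hu.2.le))
    intro O hO
    have hO : t ≤ |f (O.1 a) - ∫ P, f (P.1 a) ∂μ| := hO
    change t - u ≤ |g (O.1 a) - ∫ P, g (P.1 a) ∂μ|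
    have h1 := hgf (O.1 a)
    have h2 : f (O.1 a) - ∫ P, f (P.1 a) ∂μ = (g (O.1 a) - ∫ P, g (P.1 a) ∂μ) -
        (g (O.1 a) - f (O.1 a)) + (∫ P, g (P.1 a) ∂μ - ∫ P, f (P.1 a) ∂μ) := by ring
    have h3 := abs_add_le ((g (O.1 a) - ∫ P, g (P.1 a) ∂μ) - (g (O.1 a) - f (O.1 a)))
      (∫ P, g (P.1 a) ∂μ - ∫ P, f (P.1 a) ∂μ)
    have h4 := abs_sub (g (O.1 a) - ∫ P, g (P.1 a) ∂μ) (g (O.1 a) - f (O.1 a))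
    rw [← h2] at h3
    linarith
  have hlim : Filter.Tendsto
      (fun u : ℝ => 2 * Real.exp (-(1 / 64 * ((m + 1 : ℕ) : ℝ) * (t - u) ^ 2) / K ^ 2))
      (nhdsWithin 0 (Set.Ioi 0))
      (nhds (2 * Real.exp (-(1 / 64 * ((m + 1 : ℕ) : ℝ) * t ^ 2) / K ^ 2))) := by
    have hc : Continuous
        fun u : ℝ => 2 * Real.exp (-(1 / 64 * ((m + 1 : ℕ) : ℝ) * (t - u) ^ 2) / K ^ 2) := by
      fun_prop
    have := hc.tendsto 0
    rw [sub_zero] at this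
    exact this.mono_left nhdsWithin_le_nhds
  exact ge_of_tendsto hlim (Filter.eventually_of_mem (Ioo_mem_nhdsGT ht) hbound)

/-- A rotation-invariant probability measure on the sphere is the image of the Haar measure on the
orthogonal group under an orbit map. -/
lemma eq_map_unitary_apply [MeasurableSpace E] [BorelSpace E] {ρ : Measure E}
    [IsProbabilityMeasure ρ] (hρ : ρ (Metric.sphere 0 1) = 1)
    (hinv : ∀ O : E ≃ₗᵢ[ℝ] E, ρ.map O = ρ) {a : E} (ha : ‖a‖ = 1) :
    ρ = μ.map (fun O => O.1 a) := by
  have hmeas : Measurable fun O : unitary (E →L[ℝ] E) => O.1 a :=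
    (continuous_unitary_apply continuous_id continuous_const).measurable
  have hjoint : Measurable fun p : unitary (E →L[ℝ] E) × E => p.1.1 p.2 :=
    (continuous_unitary_apply continuous_fst continuous_snd).measurable
  have hae : ∀ᵐ x ∂ρ, ‖x‖ = 1 := by
    have h : ∀ᵐ x ∂ρ, x ∈ Metric.sphere (0 : E) 1 :=
      (prob_compl_eq_zero_iff Metric.isClosed_sphere.measurableSet).mpr hρ
    filter_upwards [h] with x hx using mem_sphere_zero_iff_norm.mp hx
  have hright := isMulRightInvariant_of_compactSpace μ
  ext B hB
  let φ : E → ENNReal := B.indicator 1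
  have hφ : Measurable φ := measurable_one.indicator hB
  calc ρ B = ∫⁻ _, ρ B ∂μ := by simp
    _ = ∫⁻ O, ∫⁻ x, φ (O.1 x) ∂ρ ∂μ := by
        refine lintegral_congr fun O => ?_
        conv_lhs => rw [← hinv (Unitary.linearIsometryEquiv O), ← lintegral_indicator_one hB]
        rw [lintegral_map hφ (LinearIsometryEquiv.continuous _).measurable]
        rfl
    _ = ∫⁻ x, ∫⁻ O, φ (O.1 x) ∂μ ∂ρ := lintegral_lintegral_swap (hφ.comp hjoint).aemeasurable
    _ = ∫⁻ _, ∫⁻ O, φ (O.1 a) ∂μ ∂ρ := by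
        refine lintegral_congr_ae ?_
        filter_upwards [hae] with x hx
        obtain ⟨g, rfl⟩ := exists_unitary_map_eq (ha.trans hx.symm)
        exact lintegral_mul_right_eq_self (μ := μ) (fun O => φ (O.1 a)) g
    _ = μ.map (fun O => O.1 a) B := by
        rw [lintegral_const, measure_univ, mul_one, ← lintegral_map hφ hmeas,
          lintegral_indicator_one hB]

/-- Concentration on spheres of dimension at least one. -/
lemma measureReal_sphere_le_of_two_le_finrank [MeasurableSpace E] [BorelSpace E] {m : ℕ}
    (hm : 0 < m) (hE : Module.finrank ℝ E = m + 1) {ρ : Measure E} [IsProbabilityMeasure ρ]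
    (hρ : ρ (Metric.sphere 0 1) = 1) (hinv : ∀ O : E ≃ₗᵢ[ℝ] E, ρ.map O = ρ) {f : E → ℝ}
    {K : NNReal} (hK0 : 0 < K) (hK : LipschitzWith K f) {t : ℝ} (ht : 0 < t) :
    ρ.real {x | t ≤ |f x - ∫ y, f y ∂ρ|} ≤
      2 * Real.exp (-(1 / 64 * ((m + 1 : ℕ) : ℝ) * t ^ 2) / K ^ 2) := by
  obtain ⟨μ, _, _⟩ := exists_isHaarMeasure_isProbabilityMeasure (unitary (E →L[ℝ] E))
  obtain ⟨a, ha⟩ : ∃ a : E, ‖a‖ = 1 :=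
    ⟨_, (stdOrthonormalBasis ℝ E).norm_eq_one (finCongr hE.symm 0)⟩
  have hmeas : Measurable fun O : unitary (E →L[ℝ] E) => O.1 a :=
    (continuous_unitary_apply continuous_id continuous_const).measurable
  have hset (r : ℝ) : MeasurableSet {x | t ≤ |f x - r|} :=
    measurableSet_le measurable_const (hK.continuous.measurable.sub_const r).abs
  rw [eq_map_unitary_apply (μ := μ) hρ hinv ha,
    integral_map hmeas.aemeasurable hK.continuous.aestronglyMeasurable,
    map_measureReal_apply hmeas (hset _)]
  exact measureReal_le_abs_sub_integral_le hm hE ha hK0 hK ht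

end OrthogonalGroup

lemma LipschitzWith.ae_abs_sub_integral_le {E : Type*} [NormedAddCommGroup E] [MeasurableSpace E]
    [BorelSpace E] {ρ : Measure E} [IsProbabilityMeasure ρ] (hρ : ∀ᵐ x ∂ρ, ‖x‖ = 1) {f : E → ℝ}
    {K : NNReal} (hK : LipschitzWith K f) : ∀ᵐ x ∂ρ, |f x - ∫ y, f y ∂ρ| ≤ 2 * K := by
  have hdist : ∀ x y : E, ‖x‖ = 1 → ‖y‖ = 1 → |f x - f y| ≤ 2 * K := fun x y hx hy => by
    have h1 := hK.dist_le_mul x y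
    have h2 : dist x y ≤ 2 := by
      rw [dist_eq_norm]
      exact (_root_.norm_sub_le x y).trans (by rw [hx, hy]; norm_num)
    rw [Real.dist_eq] at h1
    nlinarith [K.2]
  obtain ⟨x₀, hx₀⟩ := hρ.exists
  have hint : Integrable f ρ := by
    refine Integrable.of_bound (C := |f x₀| + 2 * K) ?_ ?_
    · exact hK.continuous.measurable.aestronglyMeasurable
    · filter_upwards [hρ] with x hx
      have h1 := hdist x x₀ hx hx₀
      have h2 := abs_sub_abs_le_abs_sub (f x) (f x₀)
      rw [Real.norm_eq_abs]
      linarith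
  filter_upwards [hρ] with x hx
  have h : f x - ∫ y, f y ∂ρ = ∫ y, (f x - f y) ∂ρ := by
    rw [integral_sub (integrable_const _) hint]
    simp
  rw [h, ← Real.norm_eq_abs]
  refine (norm_integral_le_of_norm_le_const (C := 2 * K) ?_).trans (by simp)
  filter_upwards [hρ] with y hy using hdist x y hx hy

lemma measureReal_sphere_le_of_lipschitzWith {E : Type*} [NormedAddCommGroup E]
    [MeasurableSpace E] [BorelSpace E] {ρ : Measure E} [IsProbabilityMeasure ρ]
    (hρ : ∀ᵐ x ∂ρ, ‖x‖ = 1) {f : E → ℝ} {K : NNReal} (hK0 : 0 < K) (hK : LipschitzWith K f)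
    {t : ℝ} (ht : 0 < t) :
    ρ.real {x | t ≤ |f x - ∫ y, f y ∂ρ|} ≤ 2 * Real.exp (-(1 / 64 * t ^ 2) / K ^ 2) := by
  have hK' : (0 : ℝ) < K := hK0
  rcases lt_or_ge (2 * (K : ℝ)) t with h | h
  · have h0 : ρ {x | t ≤ |f x - ∫ y, f y ∂ρ|} = 0 := by
      refine measure_eq_zero_iff_ae_notMem.mpr ?_
      filter_upwards [hK.ae_abs_sub_integral_le hρ] with x hx using not_le.mpr (hx.trans_lt h)
    rw [measureReal_def, h0, ENNReal.toReal_zero]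
    positivity
  · have h1 : -(1 / 2) ≤ -(1 / 64 * t ^ 2) / (K : ℝ) ^ 2 := by
      rw [le_div_iff₀ (by positivity)]
      nlinarith
    have h2 := Real.add_one_le_exp (-(1 / 64 * t ^ 2) / (K : ℝ) ^ 2)
    have h3 : ρ.real {x | t ≤ |f x - ∫ y, f y ∂ρ|} ≤ 1 := measureReal_le_one
    linarith

/-- Lévy's concentration inequality for Lipschitz functions on the sphere: there is an
absolute constant `c > 0` such that for every dimension `d`, the uniform
(rotation-invariant) probability measure `μS` on `S^{d-1}`, and every `L`-Lipschitz
function `f : S^{d-1} → ℝ`, `P(|f(x) - E[f(x)]| ≥ t) ≤ 2 exp(-c d t² / L²)` for all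
`t ≥ 0`. -/
theorem levy_concentration_on_sphere :
    ∃ c : ℝ, 0 < c ∧
      ∀ (d : ℕ), 0 < d →
      ∀ (μS : Measure (EuclideanSpace ℝ (Fin d))), IsProbabilityMeasure μS →
        μS (Metric.sphere (0 : EuclideanSpace ℝ (Fin d)) 1) = 1 →
        (∀ O : EuclideanSpace ℝ (Fin d) ≃ₗᵢ[ℝ] EuclideanSpace ℝ (Fin d),
          μS.map O = μS) →
      ∀ (f : EuclideanSpace ℝ (Fin d) → ℝ) (L : ℝ), 0 < L →
        LipschitzOnWith (Real.toNNReal L) f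
          (Metric.sphere (0 : EuclideanSpace ℝ (Fin d)) 1) →
      ∀ t : ℝ, 0 ≤ t →
        (μS {x | t ≤ |f x - ∫ y, f y ∂μS|}).toReal
          ≤ 2 * Real.exp (-(c * d * t ^ 2) / L ^ 2) := by
  refine ⟨1 / 64, by norm_num, fun d hd μS _ hS hinv f L hL hf t ht => ?_⟩
  obtain ⟨g, hgL, hfg⟩ := hf.extend_real
  set K := Real.toNNReal L with hK
  have hKL : (K : ℝ) = L := Real.coe_toNNReal L hL.le
  have hsphere : ∀ᵐ x ∂μS, x ∈ Metric.sphere (0 : EuclideanSpace ℝ (Fin d)) 1 :=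
    (prob_compl_eq_zero_iff Metric.isClosed_sphere.measurableSet).mpr hS
  have hae : f =ᵐ[μS] g := by
    filter_upwards [hsphere] with x hx using hfg hx
  have hset : μS {x | t ≤ |f x - ∫ y, f y ∂μS|} = μS {x | t ≤ |g x - ∫ y, g y ∂μS|} := by
    rw [integral_congr_ae hae]
    refine measure_congr ?_
    filter_upwards [hae] with x hx
    exact congrArg (fun r => t ≤ |r - ∫ y, g y ∂μS|) hx
  rw [hset]
  rcases ht.eq_or_lt with rfl | ht0
  · have h : μS.real {x | 0 ≤ |g x - ∫ y, g y ∂μS|} ≤ 1 := measureReal_le_one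
    have h2 : -(1 / 64 * (d : ℝ) * 0 ^ 2) / L ^ 2 = 0 := by simp
    rw [h2, Real.exp_zero]
    exact h.trans (by norm_num)
  obtain ⟨m, rfl⟩ : ∃ m, d = m + 1 := ⟨d - 1, by omega⟩
  rw [← measureReal_def, ← hKL]
  have hK0 : 0 < K := Real.toNNReal_pos.mpr hL
  rcases Nat.eq_zero_or_pos m with rfl | hm
  · have h := measureReal_sphere_le_of_lipschitzWith (ρ := μS)
      (hsphere.mono fun x hx => mem_sphere_zero_iff_norm.mp hx) hK0 hgL ht0
    simpa only [zero_add, Nat.cast_one, mul_one] using h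
  · exact measureReal_sphere_le_of_two_le_finrank hm (by simp) hS hinv hK0 hgL ht0
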